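/- Let H be a symmetric positive definite n×n real matrix, A an m×n real matrix, C a p×n real matrix, g ∈ ℝⁿ, b ∈ ℝᵐ, d ∈ ℝᵖ. Suppose (y*, π*, λ*, t*) satisfies the KKT conditions: H y* + g − Aᵀ π* − Cᵀ λ* = 0, A y* = b, C y* − d = t*, λ*_i t*_i = 0 for all i, λ* ≥ 0 and t* ≥ 0. Then y* is the unique global minimizer of ½ yᵀ H y + gᵀ y over the feasible set {y ∈ ℝⁿ : A y = b, C y ≥ d}: for every feasible y ≠ y*, ½ yᵀ H y + gᵀ y > ½ (y*)ᵀ H y* + gᵀ y*. -/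

import Mathlib

open Matrix

/-- A KKT point of a strictly convex QP is the unique global minimizer. -/
theorem kkt_unique_global_minimizer
    (n m p : ℕ)
    (H : Matrix (Fin n) (Fin n) ℝ) (hH : H.PosDef)
    (A : Matrix (Fin m) (Fin n) ℝ) (C : Matrix (Fin p) (Fin n) ℝ)
    (g : Fin n → ℝ) (b : Fin m → ℝ) (d : Fin p → ℝ)
    (ystar : Fin n → ℝ) (πstar : Fin m → ℝ) (lamstar tstar : Fin p → ℝ)
    (hstat : H *ᵥ ystar + g - Aᵀ *ᵥ πstar - Cᵀ *ᵥ lamstar = 0)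
    (heq : A *ᵥ ystar = b)
    (hineq : C *ᵥ ystar - d = tstar)
    (hcomp : ∀ i, lamstar i * tstar i = 0)
    (hlam : ∀ i, 0 ≤ lamstar i) (ht : ∀ i, 0 ≤ tstar i) :
    ∀ y : Fin n → ℝ, A *ᵥ y = b → (∀ i, d i ≤ (C *ᵥ y) i) → y ≠ ystar →
      (1 / 2) * (ystar ⬝ᵥ (H *ᵥ ystar)) + g ⬝ᵥ ystar
        < (1 / 2) * (y ⬝ᵥ (H *ᵥ y)) + g ⬝ᵥ y := by
  intro y hAy hCy hne
  have hpos : 0 < (y - ystar) ⬝ᵥ (H *ᵥ (y - ystar)) := by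
    simpa using hH.dotProduct_mulVec_pos (sub_ne_zero.mpr hne)
  have hsymm : ystar ⬝ᵥ (H *ᵥ y) = y ⬝ᵥ (H *ᵥ ystar) := by
    have hT : Hᵀ = H := by simpa using hH.isHermitian.eq
    rw [dotProduct_mulVec, ← mulVec_transpose, hT, dotProduct_comm]
  have hA : (y - ystar) ⬝ᵥ (Aᵀ *ᵥ πstar) = 0 := by
    rw [dotProduct_mulVec, vecMul_transpose, mulVec_sub, hAy, heq, sub_self, zero_dotProduct]
  have hC : 0 ≤ (y - ystar) ⬝ᵥ (Cᵀ *ᵥ lamstar) := by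
    rw [dotProduct_mulVec, vecMul_transpose, mulVec_sub]
    refine Finset.sum_nonneg fun i _ => ?_
    have hti : (C *ᵥ ystar) i - d i = tstar i := congrFun hineq i
    have hslack : 0 ≤ lamstar i * ((C *ᵥ y) i - d i) :=
      mul_nonneg (hlam i) (sub_nonneg.mpr (hCy i))
    simp only [Pi.sub_apply]
    linear_combination hslack + hcomp i + lamstar i * hti
  have hgrad := congrArg (fun w => (y - ystar) ⬝ᵥ w) hstat
  simp only [dotProduct_sub, dotProduct_add, dotProduct_zero, hA] at hgrad
  simp only [mulVec_sub, dotProduct_sub, sub_dotProduct] at hpos hgrad hC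
  rw [dotProduct_comm g ystar, dotProduct_comm g y]
  linarith
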